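/- Fix β ∈ (−1,1). For every ε > 0 there exist Δ₀ > 0 and x₀ > 0 such that for all α = 2−Δ with 0 < Δ < Δ₀ and all real x with |x| > x₀ one has |f(x;α,β)/g(x;α,β) − 1| < ε. Moreover, for every δ > 0 there is a function r(Δ) ≥ 0 with r(Δ)/Δ^{δ/2} → 0 as Δ → 0⁺ such that, for all such α and all |x| > x₀: |g(x;α,β)/F₁(x;α,β) − 1| ≤ r(Δ) whenever |x−ζ| ≤ (2−δ)·(log(1/Δ))^{1/2}, and |g(x;α,β)/F₂(x;α,β) − 1| ≤ r(Δ) whenever |x−ζ| ≥ (2+δ)·(log(1/Δ))^{1/2}. -/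

import Mathlib

open MeasureTheory Filter Set Topology Real

/-- Shift parameter ζ = −β·tan(πα/2) in Zolotarev's (M) parameterization. -/
noncomputable def zetaPar (α β : ℝ) : ℝ := -β * Real.tan (Real.pi * α / 2)

/-- Standard stable density in Zolotarev's (M) parameterization, via the inversion formula. -/
noncomputable def stableDensity (α β x : ℝ) : ℝ :=
  (1 / Real.pi) *
    (∫ t in Set.Ioi (0 : ℝ),
      Complex.exp (-(Complex.I * (t : ℂ) * (x : ℂ))) *
        Complex.exp (-(((t ^ α : ℝ) : ℂ)) *
          (1 + Complex.I * (β : ℂ) * ((Real.tan (Real.pi * α / 2) : ℝ) : ℂ) *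
            (((t ^ (1 - α) : ℝ) : ℂ) - 1)))).re

/-- The N(0,2) density f(y;2). -/
noncomputable def normalDensity (y : ℝ) : ℝ :=
  (1 / (2 * Real.sqrt Real.pi)) * Real.exp (-(y ^ 2) / 4)

/-- F₁(x;α,β) = f(x−ζ;2). -/
noncomputable def F1 (α β x : ℝ) : ℝ := normalDensity (x - zetaPar α β)

/-- F₂(x;α,β) = (1+β*)·Δ·|x−ζ|^{Δ−3} with Δ = 2−α and β* = β·sgn(x−ζ). -/
noncomputable def F2 (α β x : ℝ) : ℝ :=
  (1 + β * Real.sign (x - zetaPar α β)) * (2 - α) * |x - zetaPar α β| ^ ((2 - α) - 3)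

/-- g = F₁ + F₂. -/
noncomputable def gApprox (α β x : ℝ) : ℝ := F1 α β x + F2 α β x

/-- F₁′(x;α,β) = −((x−ζ)/2)·f(x−ζ;2). -/
noncomputable def F1' (α β x : ℝ) : ℝ :=
  -((x - zetaPar α β) / 2) * normalDensity (x - zetaPar α β)

/-- F₂′(x;α,β) = −3(1+β*)·Δ·sgn(x−ζ)·|x−ζ|^{Δ−4}. -/
noncomputable def F2' (α β x : ℝ) : ℝ :=
  -3 * (1 + β * Real.sign (x - zetaPar α β)) * (2 - α) * Real.sign (x - zetaPar α β) *
    |x - zetaPar α β| ^ ((2 - α) - 4)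

/-- g′ = F₁′ + F₂′. -/
noncomputable def gApprox' (α β x : ℝ) : ℝ := F1' α β x + F2' α β x


/-! ### Pointwise estimates -/

noncomputable def cc (Δ β : ℝ) : ℂ :=
  1 + Complex.I * ((β * Real.tan (π * Δ / 2) : ℝ) : ℂ)

/-- The integrand of the (centred) inversion integral, extended to complex arguments. -/
noncomputable def GG (Δ β y : ℝ) (z : ℂ) : ℂ :=
  Complex.exp (-(Complex.I * z * (y : ℂ))) *
    Complex.exp (-(cc Δ β * z ^ (((2 - Δ : ℝ)) : ℂ)))

lemma tan_bound {Δ : ℝ} (h0 : 0 < Δ) (h1 : Δ ≤ 1 / 8) :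
    0 ≤ Real.tan (π * Δ / 2) ∧ Real.tan (π * Δ / 2) ≤ 2 * Δ := by
  have hpi := Real.pi_pos
  have hpi2 := Real.pi_lt_d2
  have hx0 : 0 ≤ π * Δ / 2 := by positivity
  have hx1 : π * Δ / 2 ≤ 0.2 := by nlinarith
  have hc : 0.98 ≤ Real.cos (π * Δ / 2) := by
    have := Real.one_sub_sq_div_two_le_cos (x := π * Δ / 2)
    nlinarith
  have hs := Real.sin_le hx0
  have hs0 : 0 ≤ Real.sin (π * Δ / 2) :=
    Real.sin_nonneg_of_nonneg_of_le_pi hx0 (by nlinarith [Real.pi_gt_three])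
  rw [Real.tan_eq_sin_div_cos]
  refine ⟨by positivity, ?_⟩
  rw [div_le_iff₀ (by linarith)]
  nlinarith

lemma cpow_polar {Δ : ℝ} {z : ℂ} (hz : z ≠ 0) :
    z ^ (((2 - Δ : ℝ)) : ℂ) =
      ((‖z‖ ^ (-Δ) : ℝ) : ℂ) * (z ^ 2 * Complex.exp (Complex.I * ((-Δ * Complex.arg z : ℝ) : ℂ))) := by
  have hn : 0 < ‖z‖ := norm_pos_iff.mpr hz
  have e1 : (((2 - Δ : ℝ)) : ℂ) = (2 : ℕ) + ((-Δ : ℝ) : ℂ) := by push_cast; ring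
  rw [e1, Complex.cpow_add _ _ hz, Complex.cpow_natCast, Complex.cpow_def_of_ne_zero hz (((-Δ : ℝ)) : ℂ),
    Real.rpow_def_of_pos hn]
  have e2 : Complex.log z * (((-Δ : ℝ)) : ℂ) =
      ((Real.log ‖z‖ * (-Δ) : ℝ) : ℂ) + Complex.I * ((-Δ * Complex.arg z : ℝ) : ℂ) := by
    rw [Complex.log]; push_cast; ring
  rw [e2, Complex.exp_add, Complex.ofReal_exp]
  ring

lemma cc_exp_bound {Δ β φ : ℝ} (h0 : 0 < Δ) (h1 : Δ ≤ 1 / 8) (hβ : |β| ≤ 1) (hφ : |φ| ≤ π / 2) :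
    ‖cc Δ β * Complex.exp (Complex.I * ((-Δ * φ : ℝ) : ℂ)) - 1‖ ≤ 4 * Δ := by
  obtain ⟨ht0, ht1⟩ := tan_bound h0 h1
  have e : cc Δ β * Complex.exp (Complex.I * ((-Δ * φ : ℝ) : ℂ)) - 1 =
      (Complex.exp (Complex.I * ((-Δ * φ : ℝ) : ℂ)) - 1) +
      Complex.I * ((β * Real.tan (π * Δ / 2) : ℝ) : ℂ) *
        Complex.exp (Complex.I * ((-Δ * φ : ℝ) : ℂ)) := by
    rw [cc]; ring
  rw [e]
  refine (norm_add_le _ _).trans ?_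
  have b1 := Real.norm_exp_I_mul_ofReal_sub_one_le (x := -Δ * φ)
  have b2 : ‖Complex.exp (Complex.I * ((-Δ * φ : ℝ) : ℂ))‖ = 1 :=
    Complex.norm_exp_I_mul_ofReal _
  rw [norm_mul, norm_mul, b2, Complex.norm_I, Complex.norm_real, Real.norm_eq_abs, abs_mul,
    abs_of_nonneg ht0]
  rw [Real.norm_eq_abs, abs_mul, abs_neg, abs_of_pos h0] at b1
  have := Real.pi_lt_d2
  have : Δ * |φ| ≤ Δ * 2 := by gcongr; linarith
  have : |β| * Real.tan (π * Δ / 2) ≤ 1 * (2 * Δ) := by gcongr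
  linarith

lemma main_pointwise {Δ β M v s : ℝ} {z : ℂ} (h0 : 0 < Δ) (h1 : Δ ≤ 1 / 8) (hβ : |β| ≤ 1)
    (hM : 1 ≤ M) (hΔM : Δ * M ^ 2 ≤ 1 / 4) (hv : 0 ≤ v) (hs : 0 ≤ s) (hsM : s ≤ M)
    (hz : z = (v : ℂ) + ((-s : ℝ) : ℂ) * Complex.I) (hz1 : 1 ≤ ‖z‖) :
    v / 2 - 2 - s ^ 2 ≤ (cc Δ β * z ^ (((2 - Δ : ℝ)) : ℂ)).re ∧
    ‖cc Δ β * z ^ (((2 - Δ : ℝ)) : ℂ) - z ^ 2‖ ≤ 4 * Δ * (v + s) ^ 3 := by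
  have hz0 : z ≠ 0 := by
    intro h; rw [h] at hz1; simp at hz1; linarith
  have hre : z.re = v := by simp [hz]
  have him : z.im = -s := by simp [hz]
  have harg : |Complex.arg z| ≤ π / 2 := by
    rw [Complex.abs_arg_le_pi_div_two_iff, hre]; exact hv
  set e : ℂ := cc Δ β * Complex.exp (Complex.I * ((-Δ * Complex.arg z : ℝ) : ℂ)) - 1 with he
  have heb : ‖e‖ ≤ 4 * Δ := cc_exp_bound h0 h1 hβ harg
  set ρ := ‖z‖ with hρ
  have hρ2 : ρ ^ 2 = v ^ 2 + s ^ 2 := by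
    rw [hρ, ← Complex.normSq_eq_norm_sq, Complex.normSq_apply, hre, him]; ring
  have hρle : ρ ≤ v + s := by
    nlinarith [mul_nonneg hv hs]
  set P := ρ ^ (-Δ) with hP
  have hρ0 : 0 < ρ := by linarith
  have hP0 : 0 < P := Real.rpow_pos_of_pos hρ0 _
  have hP1 : P ≤ 1 := Real.rpow_le_one_of_one_le_of_nonpos hz1 (by linarith)
  have key : cc Δ β * z ^ (((2 - Δ : ℝ)) : ℂ) = (P : ℂ) * (z ^ 2 * (1 + e)) := by
    rw [cpow_polar hz0, he]; ring
  have hz2re : (z ^ 2).re = v ^ 2 - s ^ 2 := by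
    rw [pow_two, Complex.mul_re, hre, him]; ring
  have hze : ‖z ^ 2 * e‖ ≤ 4 * Δ * ρ ^ 2 := by
    rw [norm_mul, norm_pow]; nlinarith [sq_nonneg ρ]
  rw [key]
  constructor
  · rw [Complex.re_ofReal_mul, mul_add, mul_one, Complex.add_re, hz2re]
    have h3 : -(4 * Δ * ρ ^ 2) ≤ (z ^ 2 * e).re := by
      have := (abs_le.mp (Complex.abs_re_le_norm (z ^ 2 * e))).1
      linarith
    have h4 : ρ ^ Δ ≤ 2 + v := by
      have := rpow_one_add_le_one_add_mul_self (s := ρ - 1) (by linarith) h0.le (by linarith)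
      rw [show 1 + (ρ - 1) = ρ by ring] at this
      nlinarith [mul_nonneg h0.le hv]
    have h5 : 1 / (2 + v) ≤ P := by
      rw [hP, Real.rpow_neg hρ0.le, ← one_div]
      exact one_div_le_one_div_of_le (Real.rpow_pos_of_pos hρ0 _) h4
    have h6 : (v - 2) / 2 ≤ P * ((1 - 4 * Δ) * v ^ 2) := by
      have : (1 / (2 + v)) * (1 / 2 * v ^ 2) ≤ P * ((1 - 4 * Δ) * v ^ 2) := by
        apply mul_le_mul h5 _ (by positivity) hP0.le
        apply mul_le_mul_of_nonneg_right _ (by positivity); linarith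
      refine le_trans ?_ this
      rw [one_div_mul_eq_div, le_div_iff₀ (by linarith)]
      nlinarith
    have h7 : P * ((1 + 4 * Δ) * s ^ 2) ≤ (1 + 4 * Δ) * s ^ 2 := by
      apply mul_le_of_le_one_left _ hP1; positivity
    have h8 : Δ * s ^ 2 ≤ 1 / 4 := by
      refine le_trans ?_ hΔM; gcongr
    have h9 : P * (v ^ 2 - s ^ 2 - 4 * Δ * ρ ^ 2) ≤ P * (v ^ 2 - s ^ 2 + (z ^ 2 * e).re) := by
      gcongr; linarith
    rw [hρ2] at h9
    nlinarith
  · have e1 : (P : ℂ) * (z ^ 2 * (1 + e)) - z ^ 2 = ((P - 1 : ℝ) : ℂ) * z ^ 2 + (P : ℂ) * (z ^ 2 * e) := by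
      push_cast; ring
    rw [e1]
    refine (norm_add_le _ _).trans ?_
    rw [norm_mul, norm_mul (P : ℂ), Complex.norm_real, Complex.norm_real, norm_pow,
      Real.norm_eq_abs, Real.norm_eq_abs, abs_of_pos hP0, abs_of_nonpos (by linarith)]
    have h3 : -(P - 1) ≤ Δ * (ρ - 1) := by
      have h5 : 1 - Δ * (ρ - 1) ≤ P := by
        rw [hP, Real.rpow_def_of_pos hρ0]
        have := Real.add_one_le_exp (Real.log ρ * -Δ)
        have := Real.log_le_sub_one_of_pos hρ0
        nlinarith
      linarith
    have h4 : P * ‖z ^ 2 * e‖ ≤ 4 * Δ * ρ ^ 2 := by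
      nlinarith [norm_nonneg (z ^ 2 * e)]
    have h5 : -(P - 1) * ρ ^ 2 ≤ Δ * (ρ - 1) * ρ ^ 2 := by gcongr
    have h6 : ρ ^ 3 ≤ (v + s) ^ 3 := by gcongr
    have h7 : ρ ^ 2 ≤ ρ ^ 3 := by nlinarith [sq_nonneg ρ]
    calc -(P - 1) * ‖z‖ ^ 2 + P * ‖z ^ 2 * e‖ ≤ Δ * (ρ - 1) * ρ ^ 2 + 4 * Δ * ρ ^ 2 := by
          linarith
      _ = Δ * (ρ ^ 3 + 3 * ρ ^ 2) := by ring
      _ ≤ Δ * (4 * ρ ^ 3) := by gcongr; linarith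
      _ ≤ Δ * (4 * (v + s) ^ 3) := by gcongr
      _ = _ := by ring

lemma norm_exp_sub_exp_le' {u w : ℂ} {R : ℝ} (hu : u.re ≤ R) (hw : w.re ≤ R) :
    ‖Complex.exp u - Complex.exp w‖ ≤ Real.exp R * ‖u - w‖ := by
  refine Convex.norm_image_sub_le_of_norm_hasDerivWithin_le (𝕜 := ℂ) (s := {z : ℂ | z.re ≤ R})
    (f := Complex.exp) (f' := Complex.exp)
    (fun x _ => (Complex.hasDerivAt_exp x).hasDerivWithinAt) ?_ (convex_halfSpace_re_le R) hw hu
  intro x hx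
  rw [Complex.norm_exp]
  exact Real.exp_le_exp.mpr hx

lemma norm_exp_cc_le {Δ β M v s : ℝ} {z : ℂ} (h0 : 0 < Δ) (h1 : Δ ≤ 1 / 8) (hβ : |β| ≤ 1)
    (hM : 1 ≤ M) (hΔM : Δ * M ^ 2 ≤ 1 / 4) (hv : 0 ≤ v) (hs : 0 ≤ s) (hsM : s ≤ M)
    (hz : z = (v : ℂ) + ((-s : ℝ) : ℂ) * Complex.I) (hz1 : 1 ≤ ‖z‖) :
    ‖Complex.exp (-(cc Δ β * z ^ (((2 - Δ : ℝ)) : ℂ)))‖ ≤ Real.exp (2 + s ^ 2 - v / 2) := by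
  rw [Complex.norm_exp, Real.exp_le_exp, Complex.neg_re]
  have := (main_pointwise h0 h1 hβ hM hΔM hv hs hsM hz hz1).1
  linarith

lemma norm_exp_lin {y v s : ℝ} {z : ℂ} (hz : z = (v : ℂ) + ((-s : ℝ) : ℂ) * Complex.I) :
    ‖Complex.exp (-(Complex.I * z * (y : ℂ)))‖ = Real.exp (-(s * y)) := by
  rw [Complex.norm_exp]; congr 1; simp [hz]

lemma norm_GG_le {Δ β M v s y : ℝ} {z : ℂ} (h0 : 0 < Δ) (h1 : Δ ≤ 1 / 8) (hβ : |β| ≤ 1)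
    (hM : 1 ≤ M) (hΔM : Δ * M ^ 2 ≤ 1 / 4) (hv : 0 ≤ v) (hs : 0 ≤ s) (hsM : s ≤ M)
    (hz : z = (v : ℂ) + ((-s : ℝ) : ℂ) * Complex.I) (hz1 : 1 ≤ ‖z‖) :
    ‖GG Δ β y z‖ ≤ Real.exp (2 + s ^ 2 - s * y) * Real.exp (-(1 / 2) * v) := by
  rw [GG, norm_mul, norm_exp_lin hz]
  refine (mul_le_mul_of_nonneg_left (norm_exp_cc_le h0 h1 hβ hM hΔM hv hs hsM hz hz1)
    (Real.exp_nonneg _)).trans ?_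
  rw [← Real.exp_add, ← Real.exp_add, Real.exp_le_exp]
  linarith

lemma norm_GG_sub_le {Δ β M v s y : ℝ} {z : ℂ} (h0 : 0 < Δ) (h1 : Δ ≤ 1 / 8) (hβ : |β| ≤ 1)
    (hM : 1 ≤ M) (hΔM : Δ * M ^ 2 ≤ 1 / 4) (hv : 0 ≤ v) (hs : 0 ≤ s) (hsM : s ≤ M)
    (hz : z = (v : ℂ) + ((-s : ℝ) : ℂ) * Complex.I) (hz1 : 1 ≤ ‖z‖) :
    ‖GG Δ β y z - Complex.exp (-(Complex.I * z * (y : ℂ))) * Complex.exp (-z ^ 2)‖ ≤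
      (4 * Δ * M ^ 3 * Real.exp (2 + s ^ 2 - s * y)) * ((1 + v) ^ 3 * Real.exp (-(1 / 2) * v)) := by
  rw [GG, ← mul_sub, norm_mul, norm_exp_lin hz]
  obtain ⟨m1, m2⟩ := main_pointwise h0 h1 hβ hM hΔM hv hs hsM hz hz1
  have hre : z.re = v := by simp [hz]
  have him : z.im = -s := by simp [hz]
  have hz2re : (-z ^ 2).re = s ^ 2 - v ^ 2 := by
    rw [Complex.neg_re, pow_two, Complex.mul_re, hre, him]; ring
  have b := norm_exp_sub_exp_le' (u := -(cc Δ β * z ^ (((2 - Δ : ℝ)) : ℂ))) (w := -z ^ 2)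
    (R := 2 + s ^ 2 - v / 2) (by rw [Complex.neg_re]; linarith)
    (by rw [hz2re]; nlinarith [sq_nonneg (v - 1 / 4)])
  have e : ‖-(cc Δ β * z ^ (((2 - Δ : ℝ)) : ℂ)) - -z ^ 2‖ =
      ‖cc Δ β * z ^ (((2 - Δ : ℝ)) : ℂ) - z ^ 2‖ := by
    rw [← norm_neg]; congr 1; ring
  rw [e] at b
  have h3 : (v + s) ^ 3 ≤ (M * (1 + v)) ^ 3 := by
    gcongr; nlinarith
  calc _ ≤ Real.exp (-(s * y)) * (Real.exp (2 + s ^ 2 - v / 2) * (4 * Δ * (M * (1 + v)) ^ 3)) := by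
        gcongr
        refine b.trans ?_
        gcongr
        refine m2.trans ?_
        gcongr
    _ = _ := by
        have e1 : Real.exp (2 + s ^ 2 - s * y) = Real.exp (2 + s ^ 2) * Real.exp (-(s * y)) := by
          rw [← Real.exp_add]; congr 1
        have e2 : Real.exp (2 + s ^ 2 - v / 2) = Real.exp (2 + s ^ 2) * Real.exp (-(1 / 2) * v) := by
          rw [← Real.exp_add]; congr 1; ring
        rw [e1, e2]
        ring

/-! ### Contour shift -/

lemma GG_continuousAt {Δ β y : ℝ} (h1 : Δ ≤ 1 / 8) {z : ℂ} (hz : 0 ≤ z.re) :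
    ContinuousAt (GG Δ β y) z := by
  have h : ContinuousAt (fun z : ℂ => z ^ (((2 - Δ : ℝ)) : ℂ)) z :=
    Complex.continuousAt_cpow_const_of_re_pos (Or.inl hz) (by rw [Complex.ofReal_re]; linarith)
  unfold GG
  refine ContinuousAt.mul (by fun_prop) ?_
  exact (continuousAt_const.mul h).neg.cexp

lemma GG_differentiableAt {Δ β y : ℝ} {z : ℂ} (hz : 0 < z.re) :
    DifferentiableAt ℂ (GG Δ β y) z := by
  have h : DifferentiableAt ℂ (fun z : ℂ => z ^ (((2 - Δ : ℝ)) : ℂ)) z :=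
    differentiableAt_id.cpow (differentiableAt_const _) (Or.inl hz)
  unfold GG
  refine DifferentiableAt.mul (by fun_prop) ?_
  exact (h.const_mul _).neg.cexp

lemma norm_ge_re {v s : ℝ} (hv : 1 ≤ v) : 1 ≤ ‖(v : ℂ) + ((-s : ℝ) : ℂ) * Complex.I‖ := by
  have := Complex.abs_re_le_norm ((v : ℂ) + ((-s : ℝ) : ℂ) * Complex.I)
  simp only [Complex.add_re, Complex.ofReal_re, Complex.re_ofReal_mul, Complex.I_re, mul_zero,
    add_zero] at this
  exact hv.trans ((le_abs_self v).trans this)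

lemma norm_ge_im {v s : ℝ} (hv : 1 ≤ s) : 1 ≤ ‖(v : ℂ) + ((-s : ℝ) : ℂ) * Complex.I‖ := by
  have := Complex.abs_im_le_norm ((v : ℂ) + ((-s : ℝ) : ℂ) * Complex.I)
  simp only [Complex.add_im, Complex.ofReal_im, Complex.im_ofReal_mul, Complex.I_im, mul_one,
    zero_add, abs_neg] at this
  exact hv.trans ((le_abs_self s).trans this)

lemma GG_line_continuousOn {Δ β y : ℝ} (h1 : Δ ≤ 1 / 8) (s : ℝ) :
    ContinuousOn (fun v : ℝ => GG Δ β y ((v : ℂ) + ((-s : ℝ) : ℂ) * Complex.I)) (Ici 0) := by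
  intro v hv
  apply ContinuousAt.continuousWithinAt
  have hc : ContinuousAt (fun v : ℝ => ((v : ℂ) + ((-s : ℝ) : ℂ) * Complex.I)) v := by fun_prop
  exact ContinuousAt.comp' (f := fun v : ℝ => ((v : ℂ) + ((-s : ℝ) : ℂ) * Complex.I))
    (g := GG Δ β y) (GG_continuousAt h1 (by simpa using hv)) hc

lemma GG_integrableOn {Δ β M s y : ℝ} (h0 : 0 < Δ) (h1 : Δ ≤ 1 / 8) (hβ : |β| ≤ 1)
    (hM : 1 ≤ M) (hΔM : Δ * M ^ 2 ≤ 1 / 4) (hs : 0 ≤ s) (hsM : s ≤ M) :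
    IntegrableOn (fun v : ℝ => GG Δ β y ((v : ℂ) + ((-s : ℝ) : ℂ) * Complex.I)) (Ioi 0) := by
  have hc := GG_line_continuousOn (β := β) (y := y) h1 s
  have hn : IntegrableOn (fun v : ℝ => ‖GG Δ β y ((v : ℂ) + ((-s : ℝ) : ℂ) * Complex.I)‖) (Ioi 0) := by
    refine integrable_of_isBigO_exp_neg (b := 1 / 2) (by norm_num) hc.norm ?_
    refine Asymptotics.IsBigO.of_bound (Real.exp (2 + s ^ 2 - s * y)) ?_
    filter_upwards [eventually_ge_atTop (1 : ℝ)] with v hv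
    rw [norm_norm, Real.norm_eq_abs, Real.abs_exp]
    exact norm_GG_le h0 h1 hβ hM hΔM (by linarith) hs hsM rfl (norm_ge_re hv)
  exact (integrable_norm_iff ((hc.mono Ioi_subset_Ici_self).aestronglyMeasurable
    measurableSet_Ioi)).mp hn

lemma contour_shift {Δ β M Y y : ℝ} (h0 : 0 < Δ) (h1 : Δ ≤ 1 / 8) (hβ : |β| ≤ 1)
    (hM : 1 ≤ M) (hΔM : Δ * M ^ 2 ≤ 1 / 4) (hs : 0 ≤ Y) (hsM : Y ≤ M) :
    ∫ v in Ioi (0 : ℝ), GG Δ β y (v : ℂ) =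
      (∫ v in Ioi (0 : ℝ), GG Δ β y ((v : ℂ) + ((-Y : ℝ) : ℂ) * Complex.I)) -
        Complex.I * ∫ u in (-Y)..0, GG Δ β y ((u : ℂ) * Complex.I) := by
  have i0 := GG_integrableOn (y := y) h0 h1 hβ hM hΔM le_rfl (by linarith)
  simp only [neg_zero, Complex.ofReal_zero, zero_mul, add_zero] at i0
  have iY := GG_integrableOn (y := y) h0 h1 hβ hM hΔM hs hsM
  have t0 := intervalIntegral_tendsto_integral_Ioi 0 i0 tendsto_id
  have tY := intervalIntegral_tendsto_integral_Ioi 0 iY tendsto_id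
  have tR : Tendsto (fun R : ℝ => ∫ u in (-Y)..0, GG Δ β y ((R : ℂ) + (u : ℂ) * Complex.I))
      atTop (𝓝 0) := by
    have : Tendsto (fun R : ℝ => (Real.exp (2 + Y ^ 2 + Y * |y|) * Real.exp (-(1 / 2) * R)) * |0 - (-Y)|)
        atTop (𝓝 0) := by
      have h2 : Tendsto (fun R : ℝ => Real.exp (-(1 / 2) * R)) atTop (𝓝 0) :=
        Real.tendsto_exp_atBot.comp (tendsto_id.const_mul_atTop_of_neg (by norm_num))
      have := (h2.const_mul (Real.exp (2 + Y ^ 2 + Y * |y|))).mul_const (|0 - (-Y)|)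
      simpa using this
    refine squeeze_zero_norm' ?_ this
    filter_upwards [eventually_ge_atTop (1 : ℝ)] with R hR
    refine intervalIntegral.norm_integral_le_of_norm_le_const ?_
    intro u hu
    rw [uIoc_of_le (by linarith)] at hu
    have hu1 := hu.1
    have hu2 := hu.2
    have e : (u : ℂ) = ((-(-u) : ℝ) : ℂ) := by rw [neg_neg]
    have hb := norm_GG_le (z := (R : ℂ) + (u : ℂ) * Complex.I) (v := R) (s := -u) (y := y)
      h0 h1 hβ hM hΔM (by linarith) (by linarith) (by linarith) (by rw [← e])
      (by rw [e]; exact norm_ge_re hR)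
    refine hb.trans ?_
    gcongr ?_ * _
    rw [Real.exp_le_exp]
    have : -(-u * y) ≤ Y * |y| := by
      have h5 : u * y ≤ |u| * |y| := by rw [← abs_mul]; exact le_abs_self _
      have h6 : |u| * |y| ≤ Y * |y| := by
        gcongr; rw [abs_le]; constructor <;> linarith
      linarith
    nlinarith
  have hrect : ∀ R : ℝ, 0 ≤ R →
      (∫ v in (0 : ℝ)..R, GG Δ β y ((v : ℂ) + ((-Y : ℝ) : ℂ) * Complex.I)) -
      (∫ v in (0 : ℝ)..R, GG Δ β y (v : ℂ)) +
      Complex.I * (∫ u in (-Y)..0, GG Δ β y ((R : ℂ) + (u : ℂ) * Complex.I)) -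
      Complex.I * (∫ u in (-Y)..0, GG Δ β y ((u : ℂ) * Complex.I)) = 0 := by
    intro R hR
    have hz := Complex.integral_boundary_rect_eq_zero_of_continuousOn_of_differentiableOn (GG Δ β y)
      (((-Y : ℝ) : ℂ) * Complex.I) (R : ℂ) ?_ ?_
    · simpa using hz
    · intro z hz
      apply ContinuousAt.continuousWithinAt
      apply GG_continuousAt h1
      have := (Complex.mem_reProdIm.mp hz).1
      simp [uIcc_of_le hR] at this
      exact this.1
    · intro z hz
      apply DifferentiableAt.differentiableWithinAt
      apply GG_differentiableAt
      have := (Complex.mem_reProdIm.mp hz).1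
      simp [hR] at this
      exact this.1
  have tall := ((tY.sub t0).add (tR.const_mul Complex.I)).sub_const
    (Complex.I * (∫ u in (-Y)..0, GG Δ β y ((u : ℂ) * Complex.I)))
  have tz : Tendsto (fun _ : ℝ => (0 : ℂ)) atTop (𝓝 0) := tendsto_const_nhds
  have := tendsto_nhds_unique (tz.congr' ?_) tall
  · rw [mul_zero, add_zero] at this
    linear_combination this
  · filter_upwards [eventually_ge_atTop (0 : ℝ)] with R hR
    exact (hrect R hR).symm

lemma GG_vertical {Δ β y s : ℝ} (hΔ : 0 < Δ) (h1 : Δ ≤ 1 / 8) (hs : 0 < s) :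
    (GG Δ β y (((-s : ℝ) : ℂ) * Complex.I)).im =
      Real.exp (-(s * y)) * (Real.exp ((Real.cos (π * Δ / 2) -
        β * Real.tan (π * Δ / 2) * Real.sin (π * Δ / 2)) * s ^ (2 - Δ)) *
        Real.sin ((1 + β) * Real.sin (π * Δ / 2) * s ^ (2 - Δ))) := by
  set z : ℂ := ((-s : ℝ) : ℂ) * Complex.I with hz
  have hz0 : z ≠ 0 := by
    simp [hz, hs.ne']
  have hnorm : ‖z‖ = s := by simp [hz, abs_of_pos hs]
  have harg : Complex.arg z = -(π / 2) := by
    rw [Complex.arg_eq_neg_pi_div_two_iff]; simp [hz, hs]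
  have hcos : Real.cos (π * Δ / 2) ≠ 0 := by
    apply ne_of_gt
    apply Real.cos_pos_of_mem_Ioo
    constructor <;> nlinarith [Real.pi_pos]
  have hz2 : z ^ 2 = -((s ^ 2 : ℝ) : ℂ) := by
    rw [hz, mul_pow, Complex.I_sq]; push_cast; ring
  have hpow : s ^ (-Δ) * s ^ 2 = s ^ (2 - Δ) := by
    rw [← Real.rpow_natCast, ← Real.rpow_add hs]; congr 1; push_cast; ring
  set a := Real.cos (π * Δ / 2) - β * Real.tan (π * Δ / 2) * Real.sin (π * Δ / 2) with ha
  set b := (1 + β) * Real.sin (π * Δ / 2) with hb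
  have hce : cc Δ β * Complex.exp (Complex.I * ((-Δ * Complex.arg z : ℝ) : ℂ)) =
      (a : ℂ) + (b : ℂ) * Complex.I := by
    have : Complex.I * ((-Δ * Complex.arg z : ℝ) : ℂ) = ((π * Δ / 2 : ℝ) : ℂ) * Complex.I := by
      rw [harg]; push_cast; ring
    rw [this, Complex.exp_mul_I, cc, ← Complex.ofReal_cos, ← Complex.ofReal_sin]
    have hb' : b = Real.sin (π * Δ / 2) + β * Real.tan (π * Δ / 2) * Real.cos (π * Δ / 2) := by
      rw [hb, mul_assoc β, Real.tan_mul_cos hcos]; ring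
    rw [ha, hb']
    generalize Real.tan (π * Δ / 2) = t
    generalize Real.sin (π * Δ / 2) = S
    generalize Real.cos (π * Δ / 2) = C
    push_cast
    linear_combination ((β * t * S : ℂ)) * Complex.I_sq
  have key : -(cc Δ β * z ^ (((2 - Δ : ℝ)) : ℂ)) =
      ((a * s ^ (2 - Δ) : ℝ) : ℂ) + ((b * s ^ (2 - Δ) : ℝ) : ℂ) * Complex.I := by
    rw [cpow_polar hz0, hnorm, hz2]
    have : cc Δ β * (((s ^ (-Δ) : ℝ) : ℂ) * (-((s ^ 2 : ℝ) : ℂ) *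
        Complex.exp (Complex.I * ((-Δ * Complex.arg z : ℝ) : ℂ)))) =
        -(((s ^ (-Δ) * s ^ 2 : ℝ)) : ℂ) *
          (cc Δ β * Complex.exp (Complex.I * ((-Δ * Complex.arg z : ℝ) : ℂ))) := by
      push_cast; ring
    rw [this, hce, hpow]
    push_cast; ring
  have key2 : -(Complex.I * z * (y : ℂ)) = ((-(s * y) : ℝ) : ℂ) := by
    rw [hz]; push_cast; linear_combination (s * y : ℂ) * Complex.I_sq
  rw [GG, key, key2, ← Complex.ofReal_exp, Complex.im_ofReal_mul, Complex.exp_im]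
  congr 1
  simp

/-! ### The heavy tail part -/

lemma q_sub_sin_le {q : ℝ} (hq : 0 ≤ q) : |Real.sin q - q| ≤ q ^ 2 := by
  rw [abs_sub_comm, abs_of_nonneg (by linarith [Real.sin_le hq])]
  rcases hq.eq_or_lt with rfl | hq0
  · simp
  rcases le_or_gt q 1 with h1 | h1
  · have := Real.sin_gt_sub_cube hq0
    nlinarith [sq_nonneg q]
  · rcases le_or_gt q 2 with h2 | h2
    · have := Real.sin_nonneg_of_nonneg_of_le_pi hq (by linarith [Real.pi_gt_three])
      nlinarith
    · have := Real.neg_one_le_sin q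
      nlinarith

/-- the integrand on the vertical segment -/
noncomputable def VV (Δ β y s : ℝ) : ℝ :=
  Real.exp (-(s * y)) * (Real.exp ((Real.cos (π * Δ / 2) -
        β * Real.tan (π * Δ / 2) * Real.sin (π * Δ / 2)) * s ^ (2 - Δ)) *
        Real.sin ((1 + β) * Real.sin (π * Δ / 2) * s ^ (2 - Δ)))

lemma ab_bounds {Δ β : ℝ} (h0 : 0 < Δ) (h1 : Δ ≤ 1 / 8) (hβ : |β| ≤ 1) :
    0 ≤ Real.cos (π * Δ / 2) - β * Real.tan (π * Δ / 2) * Real.sin (π * Δ / 2) ∧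
    Real.cos (π * Δ / 2) - β * Real.tan (π * Δ / 2) * Real.sin (π * Δ / 2) ≤ 5 / 4 ∧
    0 ≤ (1 + β) * Real.sin (π * Δ / 2) ∧ (1 + β) * Real.sin (π * Δ / 2) ≤ 1 / 2 := by
  obtain ⟨ht0, ht1⟩ := tan_bound h0 h1
  have hpi := Real.pi_pos
  have hpi2 := Real.pi_lt_d2
  have hx0 : 0 ≤ π * Δ / 2 := by positivity
  have hx1 : π * Δ / 2 ≤ 0.2 := by nlinarith
  have hc : 0.98 ≤ Real.cos (π * Δ / 2) := by
    have := Real.one_sub_sq_div_two_le_cos (x := π * Δ / 2)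
    nlinarith
  have hs := Real.sin_le hx0
  have hs0 : 0 ≤ Real.sin (π * Δ / 2) :=
    Real.sin_nonneg_of_nonneg_of_le_pi hx0 (by nlinarith [Real.pi_gt_three])
  have hc1 := Real.cos_le_one (π * Δ / 2)
  have hb := abs_le.mp hβ
  have h3 : |β * Real.tan (π * Δ / 2) * Real.sin (π * Δ / 2)| ≤ 1 / 4 := by
    rw [abs_mul, abs_mul, abs_of_nonneg ht0, abs_of_nonneg hs0]
    calc |β| * Real.tan (π * Δ / 2) * Real.sin (π * Δ / 2) ≤ 1 * (1 / 4) * 1 := by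
          gcongr <;> linarith
      _ = 1 / 4 := by norm_num
  have h4 := abs_le.mp h3
  refine ⟨by linarith, by linarith, mul_nonneg (by linarith) hs0, ?_⟩
  calc (1 + β) * Real.sin (π * Δ / 2) ≤ 2 * 0.2 := by gcongr <;> linarith
    _ ≤ 1 / 2 := by norm_num

lemma VV_bound {Δ β y s : ℝ} (h0 : 0 < Δ) (h1 : Δ ≤ 1 / 8) (hβ : |β| ≤ 1) (hs : 0 < s)
    (hsy : s ≤ y / 2) :
    |VV Δ β y s - (1 + β) * Real.sin (π * Δ / 2) * (s ^ (2 - Δ) * Real.exp (-(y * s)))| ≤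
      (1 + β) * Real.sin (π * Δ / 2) * (2 * Real.exp (5 / 4)) *
        (s ^ (4 - 2 * Δ) * Real.exp (-(3 / 8 * y * s))) := by
  obtain ⟨a0, a1, b0, b1⟩ := ab_bounds h0 h1 hβ
  unfold VV
  set a := Real.cos (π * Δ / 2) - β * Real.tan (π * Δ / 2) * Real.sin (π * Δ / 2)
  set b := (1 + β) * Real.sin (π * Δ / 2)
  have hsq : s ^ (4 - 2 * Δ) = (s ^ (2 - Δ)) ^ 2 := by
    rw [← Real.rpow_natCast, ← Real.rpow_mul hs.le]; congr 1; push_cast; ring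
  have hle : s ^ (2 - Δ) ≤ 1 + s ^ 2 := by
    rcases le_or_gt s 1 with h | h
    · have := Real.rpow_le_one hs.le h (by linarith : (0 : ℝ) ≤ 2 - Δ)
      nlinarith
    · have := Real.rpow_le_rpow_of_exponent_le h.le (by linarith : 2 - Δ ≤ (2 : ℝ))
      rw [Real.rpow_two] at this
      linarith
  have hw0 : 0 ≤ s ^ (2 - Δ) := Real.rpow_nonneg hs.le _
  rw [hsq]
  set w := s ^ (2 - Δ)
  have e1 : Real.exp (-(s * y)) * (Real.exp (a * w) * Real.sin (b * w)) -
      b * (w * Real.exp (-(y * s))) = Real.exp (-(y * s)) *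
        (Real.exp (a * w) * (Real.sin (b * w) - b * w) + b * w * (Real.exp (a * w) - 1)) := by
    rw [mul_comm s y]; ring
  rw [e1, abs_mul, Real.abs_exp]
  have p0 : 0 ≤ a * w := mul_nonneg a0 hw0
  have q0 : 0 ≤ b * w := mul_nonneg b0 hw0
  have hp : Real.exp (a * w) - 1 ≤ a * w * Real.exp (a * w) := by
    have := Real.add_one_le_exp (-(a * w))
    rw [Real.exp_neg] at this
    have h6 := Real.exp_pos (a * w)
    have : (-(a * w) + 1) * Real.exp (a * w) ≤ 1 := by
      calc _ ≤ (Real.exp (a * w))⁻¹ * Real.exp (a * w) := by gcongr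
        _ = 1 := inv_mul_cancel₀ h6.ne'
    linarith
  have hp0 : 0 ≤ Real.exp (a * w) - 1 := by linarith [Real.add_one_le_exp (a * w)]
  have b2 : |Real.exp (a * w) * (Real.sin (b * w) - b * w) + b * w * (Real.exp (a * w) - 1)| ≤
      Real.exp (a * w) * (b * 2 * w ^ 2) := by
    refine (abs_add_le _ _).trans ?_
    rw [abs_mul, abs_mul, Real.abs_exp, abs_of_nonneg q0, abs_of_nonneg hp0]
    calc _ ≤ Real.exp (a * w) * (b * w) ^ 2 + b * w * (a * w * Real.exp (a * w)) := by
          gcongr; exact q_sub_sin_le q0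
      _ = Real.exp (a * w) * (b * (a + b) * w ^ 2) := by ring
      _ ≤ _ := by gcongr; linarith
  have b3 : Real.exp (-(y * s)) * Real.exp (a * w) ≤
      Real.exp (5 / 4) * Real.exp (-(3 / 8 * y * s)) := by
    rw [← Real.exp_add, ← Real.exp_add, Real.exp_le_exp]
    have : a * w ≤ 5 / 4 * (1 + s ^ 2) := by gcongr
    nlinarith
  calc _ ≤ Real.exp (-(y * s)) * (Real.exp (a * w) * (b * 2 * w ^ 2)) := by gcongr
    _ = (Real.exp (-(y * s)) * Real.exp (a * w)) * (b * 2 * w ^ 2) := by ring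
    _ ≤ (Real.exp (5 / 4) * Real.exp (-(3 / 8 * y * s))) * (b * 2 * w ^ 2) := by gcongr
    _ = _ := by ring

lemma gamma_bdd : ∃ G : ℝ, 0 < G ∧ ∀ t ∈ Icc (3 : ℝ) 5, Real.Gamma t ≤ G := by
  have hc : ContinuousOn Real.Gamma (Icc (3 : ℝ) 5) := by
    intro t ht
    apply ContinuousAt.continuousWithinAt
    apply (Real.differentiableAt_Gamma _).continuousAt
    intro m hm
    have := ht.1
    have : (0 : ℝ) ≤ m := Nat.cast_nonneg m
    linarith
  obtain ⟨C, hC⟩ := (isCompact_Icc.image_of_continuousOn hc).bddAbove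
  refine ⟨max C 1, by positivity, fun t ht => le_max_of_le_left (hC ⟨t, ht, rfl⟩)⟩

lemma rpow_exp_integrable {p r : ℝ} (hp : -1 < p) (hr : 0 < r) :
    IntegrableOn (fun s : ℝ => s ^ p * Real.exp (-(r * s))) (Ioi 0) := by
  have := integrableOn_rpow_mul_exp_neg_mul_rpow (p := 1) (s := p) (b := r) hp one_pos hr
  simpa [Real.rpow_one] using this

lemma VV_measurable (Δ β y : ℝ) : Measurable (VV Δ β y) := by
  unfold VV; fun_prop

lemma tail_main : ∃ K : ℝ, 0 < K ∧ ∀ Δ β y Y : ℝ, 0 < Δ → Δ ≤ 1 / 8 → |β| ≤ 1 → 2 ≤ y → 1 ≤ Y →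
    Y ≤ y / 2 →
    |(∫ s in (0 : ℝ)..Y, VV Δ β y s) -
      (1 + β) * Real.sin (π * Δ / 2) * (y ^ (Δ - 3) * Real.Gamma (3 - Δ))| ≤
      (1 + β) * Real.sin (π * Δ / 2) * (y ^ (Δ - 3) * (K / y)) := by
  obtain ⟨G, hG0, hG⟩ := gamma_bdd
  refine ⟨2 * Real.exp (5 / 4) * ((8 / 3) ^ (5 : ℝ) * G), by positivity, ?_⟩
  intro Δ β y Y h0 h1 hβ hy hY hYy
  obtain ⟨a0, a1, b0, b1⟩ := ab_bounds h0 h1 hβ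
  have hy0 : 0 < y := by linarith
  set b := (1 + β) * Real.sin (π * Δ / 2) with hb
  set C := 2 * Real.exp (5 / 4) with hC
  have hC1 : 1 ≤ C := by
    have := Real.add_one_le_exp (5 / 4 : ℝ); rw [hC]; linarith
  have I1 : IntegrableOn (fun s : ℝ => s ^ (2 - Δ) * Real.exp (-(y * s))) (Ioi 0) :=
    rpow_exp_integrable (by linarith) hy0
  have I2 : IntegrableOn (fun s : ℝ => s ^ (4 - 2 * Δ) * Real.exp (-(3 / 8 * y * s))) (Ioi 0) :=
    rpow_exp_integrable (by linarith) (by positivity)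
  have J1 : ∫ s in Ioi (0 : ℝ), s ^ (2 - Δ) * Real.exp (-(y * s)) = y ^ (Δ - 3) * Real.Gamma (3 - Δ) := by
    have := Real.integral_rpow_mul_exp_neg_mul_Ioi (a := 3 - Δ) (r := y) (by linarith) hy0
    rw [show (3 - Δ - 1) = 2 - Δ by ring] at this
    rw [this, one_div, Real.inv_rpow hy0.le, ← Real.rpow_neg hy0.le]
    congr 2; ring
  have J2 : ∫ s in Ioi (0 : ℝ), s ^ (4 - 2 * Δ) * Real.exp (-(3 / 8 * y * s)) ≤
      y ^ (Δ - 3) * (((8 / 3) ^ (5 : ℝ) * G) / y) := by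
    have := Real.integral_rpow_mul_exp_neg_mul_Ioi (a := 5 - 2 * Δ) (r := 3 / 8 * y) (by linarith)
      (by positivity)
    rw [show (5 - 2 * Δ - 1) = 4 - 2 * Δ by ring] at this
    rw [this]
    have e1 : 1 / (3 / 8 * y) = (8 / 3) * y⁻¹ := by field_simp
    rw [e1, Real.mul_rpow (by norm_num) (by positivity)]
    have g1 : ((8 : ℝ) / 3) ^ (5 - 2 * Δ) ≤ (8 / 3) ^ (5 : ℝ) :=
      Real.rpow_le_rpow_of_exponent_le (by norm_num) (by linarith)
    have g2 : Real.Gamma (5 - 2 * Δ) ≤ G := hG _ ⟨by linarith, by linarith⟩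
    have g3 : (y⁻¹) ^ (5 - 2 * Δ) ≤ y ^ (Δ - 3) * y⁻¹ := by
      rw [Real.inv_rpow hy0.le, ← Real.rpow_neg hy0.le]
      have : y ^ (Δ - 3) * y⁻¹ = y ^ (Δ - 3 + -1) := by
        rw [Real.rpow_add hy0, Real.rpow_neg_one]
      rw [this]
      exact Real.rpow_le_rpow_of_exponent_le (by linarith) (by linarith)
    have g4 : 0 ≤ Real.Gamma (5 - 2 * Δ) := Real.Gamma_nonneg_of_nonneg (by linarith)
    calc _ ≤ (8 / 3) ^ (5 : ℝ) * (y ^ (Δ - 3) * y⁻¹) * G := by gcongr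
      _ = _ := by ring
  have hind : (∫ s in (0 : ℝ)..Y, VV Δ β y s) =
      ∫ s in Ioi (0 : ℝ), (Ioc 0 Y).indicator (VV Δ β y) s := by
    rw [intervalIntegral.integral_of_le (by linarith), integral_indicator measurableSet_Ioc,
      Measure.restrict_restrict measurableSet_Ioc]
    congr 2
    exact (inter_eq_left.mpr Ioc_subset_Ioi_self).symm
  have pb : ∀ s ∈ Ioi (0 : ℝ), ‖(Ioc 0 Y).indicator (VV Δ β y) s -
      b * (s ^ (2 - Δ) * Real.exp (-(y * s)))‖ ≤
      b * C * (s ^ (4 - 2 * Δ) * Real.exp (-(3 / 8 * y * s))) := by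
    intro s hs
    have hs : 0 < s := hs
    rw [Real.norm_eq_abs]
    rcases le_or_gt s Y with h | h
    · rw [indicator_of_mem (show s ∈ Ioc 0 Y from ⟨hs, h⟩)]
      exact VV_bound h0 h1 hβ hs (h.trans hYy)
    · rw [indicator_of_notMem (by simp [h])]
      rw [zero_sub, abs_neg, abs_of_nonneg (by positivity), mul_assoc b C]
      gcongr b * ?_
      have h7 : s ^ (2 - Δ) ≤ s ^ (4 - 2 * Δ) :=
        Real.rpow_le_rpow_of_exponent_le (by linarith) (by linarith)
      have h8 : Real.exp (-(y * s)) ≤ Real.exp (-(3 / 8 * y * s)) := by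
        rw [Real.exp_le_exp]; nlinarith [mul_pos hy0 hs]
      calc s ^ (2 - Δ) * Real.exp (-(y * s)) ≤ s ^ (4 - 2 * Δ) * Real.exp (-(3 / 8 * y * s)) := by
            gcongr
        _ ≤ _ := le_mul_of_one_le_left (by positivity) hC1
  have Id : IntegrableOn (fun s => (Ioc 0 Y).indicator (VV Δ β y) s -
      b * (s ^ (2 - Δ) * Real.exp (-(y * s)))) (Ioi 0) := by
    refine Integrable.mono' (I2.const_mul (b * C)) ?_ ?_
    · apply Measurable.aestronglyMeasurable
      apply Measurable.sub ((VV_measurable _ _ _).indicator measurableSet_Ioc)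
      fun_prop
    · exact (ae_restrict_mem measurableSet_Ioi).mono pb
  have Iv : IntegrableOn ((Ioc 0 Y).indicator (VV Δ β y)) (Ioi 0) := by
    have := Id.add (I1.const_mul b)
    refine this.congr (Eventually.of_forall fun s => ?_)
    simp
  have eq : (∫ s in (0 : ℝ)..Y, VV Δ β y s) - b * (y ^ (Δ - 3) * Real.Gamma (3 - Δ)) =
      ∫ s in Ioi (0 : ℝ), ((Ioc 0 Y).indicator (VV Δ β y) s -
      b * (s ^ (2 - Δ) * Real.exp (-(y * s)))) := by
    rw [integral_sub Iv (I1.const_mul b), hind, integral_const_mul, J1]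
  rw [eq, ← Real.norm_eq_abs]
  refine (norm_integral_le_of_norm_le (I2.const_mul (b * C))
    ((ae_restrict_mem measurableSet_Ioi).mono pb)).trans ?_
  rw [integral_const_mul]
  calc _ ≤ b * C * (y ^ (Δ - 3) * (((8 / 3) ^ (5 : ℝ) * G) / y)) := by gcongr
    _ = _ := by ring

lemma tail_asymp (ε : ℝ) (hε : 0 < ε) : ∃ y₀ : ℝ, 2 ≤ y₀ ∧ ∀ᶠ Δ in 𝓝[>] (0 : ℝ),
    ∀ β y Y : ℝ, |β| ≤ 1 → y₀ ≤ y → 1 ≤ Y → Y ≤ y / 2 →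
    |1 / π * (∫ s in (0 : ℝ)..Y, VV Δ β y s) - (1 + β) * Δ * y ^ (Δ - 3)| ≤
      ε * ((1 + β) * Δ * y ^ (Δ - 3)) := by
  obtain ⟨K, hK, H⟩ := tail_main
  refine ⟨max 2 (K / ε), le_max_left _ _, ?_⟩
  have hlim : Tendsto (fun Δ : ℝ => Real.sin (π * Δ / 2) / Δ * (1 / π) * Real.Gamma (3 - Δ))
      (𝓝[>] 0) (𝓝 1) := by
    have d : HasDerivAt (fun Δ : ℝ => Real.sin (π * Δ / 2)) (π / 2) 0 := by
      have h1 : HasDerivAt (fun Δ : ℝ => π * Δ / 2) (π / 2) 0 := by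
        simpa using ((hasDerivAt_id (0 : ℝ)).const_mul π).div_const 2
      have := h1.sin
      simpa using this
    have d2 := d.tendsto_slope_zero_right
    simp only [zero_add, mul_zero, zero_div, Real.sin_zero, sub_zero, smul_eq_mul] at d2
    have g : Tendsto (fun Δ : ℝ => Real.Gamma (3 - Δ)) (𝓝[>] 0) (𝓝 2) := by
      have hc : ContinuousAt Real.Gamma (3 - 0) := by
        apply (Real.differentiableAt_Gamma _).continuousAt
        intro m hm
        have : (0 : ℝ) ≤ m := Nat.cast_nonneg m
        linarith
      have h3 : Real.Gamma (3 - 0) = 2 := by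
        have := Real.Gamma_nat_eq_factorial 2
        norm_num at this ⊢
      have hc2 : ContinuousAt (fun Δ : ℝ => Real.Gamma (3 - Δ)) 0 :=
        ContinuousAt.comp' (f := fun Δ : ℝ => 3 - Δ) hc (by fun_prop)
      have := hc2.tendsto
      rw [h3] at this
      exact this.mono_left nhdsWithin_le_nhds
    have := (d2.mul_const (1 / π)).mul g
    have e : π / 2 * (1 / π) * 2 = 1 := by field_simp
    rw [e] at this
    refine this.congr fun Δ => ?_
    rw [inv_mul_eq_div]
  have hev := (tendsto_order.1 (hlim.sub_const 1).abs).2 (ε / 2) (by simpa using hε)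
  filter_upwards [hev, self_mem_nhdsWithin, Ioc_mem_nhdsGT (show (0 : ℝ) < 1 / 8 by norm_num)]
    with Δ hΔ h0 h1 β y Y hβ hy hY hYy
  have h0 : 0 < Δ := h0
  have hy2 : 2 ≤ y := (le_max_left _ _).trans hy
  have hyK : K / ε ≤ y := (le_max_right _ _).trans hy
  have hy0 : 0 < y := by linarith
  have m := H Δ β y Y h0 h1.2 hβ hy2 hY hYy
  have hb : 0 ≤ 1 + β := by linarith [(abs_le.mp hβ).1]
  have hpi := Real.pi_pos
  have hsin : Real.sin (π * Δ / 2) ≤ π * Δ / 2 := Real.sin_le (by positivity)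
  set T := y ^ (Δ - 3) with hT
  have hT0 : 0 < T := Real.rpow_pos_of_pos hy0 _
  set S := Real.sin (π * Δ / 2) with hS
  set I := ∫ s in (0 : ℝ)..Y, VV Δ β y s with hI
  have e : 1 / π * I - (1 + β) * Δ * T = 1 / π * (I - (1 + β) * S * (T * Real.Gamma (3 - Δ))) +
      ((1 + β) * Δ * T) * (S / Δ * (1 / π) * Real.Gamma (3 - Δ) - 1) := by
    field_simp; ring
  rw [e]
  refine (abs_add_le _ _).trans ?_
  rw [abs_mul, abs_mul, abs_of_pos (by positivity : 0 < 1 / π),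
    abs_of_nonneg (by positivity : 0 ≤ (1 + β) * Δ * T)]
  have k1 : K / y ≤ ε := by
    rw [div_le_iff₀ hy0]; rw [div_le_iff₀ hε] at hyK; linarith
  have k2 : 1 / π * |I - (1 + β) * S * (T * Real.Gamma (3 - Δ))| ≤ ε / 2 * ((1 + β) * Δ * T) := by
    calc _ ≤ 1 / π * ((1 + β) * (π * Δ / 2) * (T * ε)) := by
          gcongr
          refine m.trans ?_
          gcongr
      _ = _ := by field_simp
  have k3 : ((1 + β) * Δ * T) * |S / Δ * (1 / π) * Real.Gamma (3 - Δ) - 1| ≤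
      ((1 + β) * Δ * T) * (ε / 2) := by gcongr
  linarith

/-! ### Assembling the asymptotics of the centred density -/

noncomputable def hh (Δ β y : ℝ) : ℝ := 1 / π * (∫ v in Ioi (0 : ℝ), GG Δ β y (v : ℂ)).re

lemma hh_split {Δ β M Y y : ℝ} (h0 : 0 < Δ) (h1 : Δ ≤ 1 / 8) (hβ : |β| ≤ 1)
    (hM : 1 ≤ M) (hΔM : Δ * M ^ 2 ≤ 1 / 4) (hs : 0 ≤ Y) (hsM : Y ≤ M) :
    hh Δ β y = 1 / π * (∫ v in Ioi (0 : ℝ), GG Δ β y ((v : ℂ) + ((-Y : ℝ) : ℂ) * Complex.I)).re +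
      1 / π * ∫ s in (0 : ℝ)..Y, VV Δ β y s := by
  rw [hh, contour_shift h0 h1 hβ hM hΔM hs hsM, Complex.sub_re, Complex.I_mul_re, sub_neg_eq_add,
    mul_add]
  congr 2
  have hVI : IntervalIntegrable (fun u : ℝ => GG Δ β y ((u : ℂ) * Complex.I)) volume (-Y) 0 := by
    apply Continuous.intervalIntegrable
    rw [continuous_iff_continuousAt]
    intro u
    exact ContinuousAt.comp' (f := fun u : ℝ => (u : ℂ) * Complex.I) (g := GG Δ β y)
      (GG_continuousAt h1 (by simp)) (by fun_prop)
  have e1 := Complex.imCLM.intervalIntegral_comp_comm hVI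
  simp only [Complex.imCLM_apply] at e1
  rw [← e1]
  have e2 := intervalIntegral.integral_comp_neg (a := 0) (b := Y)
    (fun u : ℝ => (GG Δ β y ((u : ℂ) * Complex.I)).im)
  rw [neg_zero] at e2
  rw [← e2]
  apply intervalIntegral.integral_congr_ae
  refine Eventually.of_forall fun s hs' => ?_
  rw [uIoc_of_le hs] at hs'
  exact GG_vertical h0 h1 hs'.1

lemma cube_exp {v : ℝ} (hv : 0 ≤ v) : (1 + v) ^ 3 ≤ 1728 * Real.exp (1 / 4 * v) := by
  have h := Real.add_one_le_exp (v / 12)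
  have h2 : 1 + v ≤ 12 * Real.exp (v / 12) := by linarith
  calc (1 + v) ^ 3 ≤ (12 * Real.exp (v / 12)) ^ 3 := by gcongr
    _ = 1728 * Real.exp (1 / 4 * v) := by
      rw [mul_pow, ← Real.exp_nat_mul]; norm_num; ring

lemma gauss_part : ∃ K : ℝ, 0 < K ∧ ∀ Δ β M y : ℝ, 0 < Δ → Δ ≤ 1 / 8 → |β| ≤ 1 →
    1 ≤ M → Δ * M ^ 2 ≤ 1 / 4 → 2 ≤ y → y / 2 ≤ M →
    |1 / π * (∫ v in Ioi (0 : ℝ), GG Δ β y ((v : ℂ) + ((-(y / 2) : ℝ) : ℂ) * Complex.I)).re -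
      normalDensity y| ≤ K * (Δ * M ^ 3) * normalDensity y := by
  set J := ∫ v in Ioi (0 : ℝ), Real.exp (-(1 / 4) * v) with hJ
  have hJint : IntegrableOn (fun v : ℝ => Real.exp (-(1 / 4) * v)) (Ioi 0) :=
    exp_neg_integrableOn_Ioi 0 (by norm_num)
  have hJ0 : 0 ≤ J := integral_nonneg fun v => (Real.exp_pos _).le
  have hpi := Real.pi_pos
  have hsp : 0 < √π := Real.sqrt_pos.mpr hpi
  refine ⟨1 / π * (4 * Real.exp 2 * 1728 * J) * (2 * √π) + 1, by positivity, ?_⟩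
  intro Δ β M y h0 h1 hβ hM hΔM hy hyM
  have hgi := GG_integrableOn (s := y / 2) (y := y) h0 h1 hβ hM hΔM (by linarith) hyM
  set E := Real.exp (-y ^ 2 / 4) with hE
  have hE0 : 0 < E := Real.exp_pos _
  have hgauss : ∀ v : ℝ, Complex.exp (-(Complex.I * ((v : ℂ) + ((-(y / 2) : ℝ) : ℂ) * Complex.I) * (y : ℂ))) *
      Complex.exp (-((v : ℂ) + ((-(y / 2) : ℝ) : ℂ) * Complex.I) ^ 2) =
      ((E * Real.exp (-1 * v ^ 2) : ℝ) : ℂ) := by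
    intro v
    rw [hE, ← Real.exp_add, Complex.ofReal_exp, ← Complex.exp_add]
    congr 1
    push_cast
    linear_combination ((y : ℂ) ^ 2 / 2 - (y : ℂ) ^ 2 / 4) * Complex.I_sq
  have hgint : IntegrableOn (fun v : ℝ => ((E * Real.exp (-1 * v ^ 2) : ℝ) : ℂ)) (Ioi 0) := by
    apply Integrable.ofReal
    exact ((integrable_exp_neg_mul_sq one_pos).const_mul E).integrableOn
  have hnd : normalDensity y = 1 / π * (∫ v in Ioi (0 : ℝ), ((E * Real.exp (-1 * v ^ 2) : ℝ) : ℂ)).re := by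
    rw [integral_complex_ofReal, Complex.ofReal_re, integral_const_mul, integral_gaussian_Ioi, div_one,
      normalDensity, ← hE]
    have : √π * √π = π := Real.mul_self_sqrt hpi.le
    field_simp
    nlinarith
  have hb : ‖(∫ v in Ioi (0 : ℝ), GG Δ β y ((v : ℂ) + ((-(y / 2) : ℝ) : ℂ) * Complex.I)) -
      ∫ v in Ioi (0 : ℝ), ((E * Real.exp (-1 * v ^ 2) : ℝ) : ℂ)‖ ≤
      (4 * Δ * M ^ 3 * (Real.exp 2 * E)) * 1728 * J := by
    rw [← integral_sub hgi hgint, hJ, ← integral_const_mul]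
    refine norm_integral_le_of_norm_le (hJint.const_mul _) ?_
    filter_upwards [ae_restrict_mem measurableSet_Ioi] with v hv
    have hv : 0 < v := hv
    rw [← hgauss]
    refine (norm_GG_sub_le h0 h1 hβ hM hΔM hv.le (by linarith) hyM rfl
      (norm_ge_im (by linarith))).trans ?_
    have e1 : Real.exp (2 + (y / 2) ^ 2 - y / 2 * y) = Real.exp 2 * E := by
      rw [hE, ← Real.exp_add]; congr 1; ring
    rw [e1, mul_assoc _ (1728 : ℝ)]
    gcongr ?_ * ?_
    calc (1 + v) ^ 3 * Real.exp (-(1 / 2) * v) ≤ (1728 * Real.exp (1 / 4 * v)) * Real.exp (-(1 / 2) * v) := by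
          gcongr; exact cube_exp hv.le
      _ = 1728 * Real.exp (-(1 / 4) * v) := by
          rw [mul_assoc, ← Real.exp_add]; congr 2; ring
  have hb2 := (Complex.abs_re_le_norm _).trans hb
  rw [Complex.sub_re] at hb2
  have e3 : 1 / π * (4 * Δ * M ^ 3 * (Real.exp 2 * E) * 1728 * J) =
      1 / π * (4 * Real.exp 2 * 1728 * J) * (2 * √π) * (Δ * M ^ 3) * normalDensity y := by
    rw [normalDensity, ← hE]; field_simp
  have hnd0 : 0 ≤ normalDensity y := by rw [normalDensity]; positivity
  calc _ ≤ 1 / π * (4 * Δ * M ^ 3 * (Real.exp 2 * E) * 1728 * J) := by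
        rw [hnd, ← mul_sub, abs_mul, abs_of_pos (by positivity : 0 < 1 / π)]
        gcongr
    _ = _ := e3
    _ ≤ _ := by
        gcongr
        linarith

lemma far_part : ∃ K : ℝ, 0 < K ∧ ∀ Δ β M y : ℝ, 0 < Δ → Δ ≤ 1 / 8 → |β| ≤ 1 →
    1 ≤ M → Δ * M ^ 2 ≤ 1 / 4 →
    |1 / π * (∫ v in Ioi (0 : ℝ), GG Δ β y ((v : ℂ) + ((-M : ℝ) : ℂ) * Complex.I)).re| ≤
      K * Real.exp (M ^ 2 - M * y) := by
  set J := ∫ v in Ioi (0 : ℝ), Real.exp (-(1 / 2) * v) with hJ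
  have hJint : IntegrableOn (fun v : ℝ => Real.exp (-(1 / 2) * v)) (Ioi 0) :=
    exp_neg_integrableOn_Ioi 0 (by norm_num)
  have hJ0 : 0 ≤ J := integral_nonneg fun v => (Real.exp_pos _).le
  have hpi := Real.pi_pos
  refine ⟨1 / π * (Real.exp 2 * J) + 1, by positivity, ?_⟩
  intro Δ β M y h0 h1 hβ hM hΔM
  have hb : ‖∫ v in Ioi (0 : ℝ), GG Δ β y ((v : ℂ) + ((-M : ℝ) : ℂ) * Complex.I)‖ ≤
      Real.exp (2 + M ^ 2 - M * y) * J := by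
    rw [hJ, ← integral_const_mul]
    refine norm_integral_le_of_norm_le (hJint.const_mul _) ?_
    filter_upwards [ae_restrict_mem measurableSet_Ioi] with v hv
    have hv : 0 < v := hv
    exact norm_GG_le h0 h1 hβ hM hΔM hv.le (by linarith) le_rfl rfl (norm_ge_im hM)
  have hb2 := (Complex.abs_re_le_norm _).trans hb
  rw [abs_mul, abs_of_pos (by positivity : 0 < 1 / π)]
  calc _ ≤ 1 / π * (Real.exp (2 + M ^ 2 - M * y) * J) := by gcongr
    _ = 1 / π * (Real.exp 2 * J) * Real.exp (M ^ 2 - M * y) := by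
        rw [show 2 + M ^ 2 - M * y = 2 + (M ^ 2 - M * y) by ring, Real.exp_add]; ring
    _ ≤ _ := by gcongr; linarith

lemma ev_MM (η : ℝ) (hη : 0 < η) : ∀ᶠ Δ in 𝓝[>] (0 : ℝ),
    0 < Δ ∧ Δ < η ∧ 1 ≤ 2 * √(-Real.log Δ) ∧ Δ * (2 * √(-Real.log Δ)) ^ 2 ≤ η ∧
    Δ * (2 * √(-Real.log Δ)) ^ 3 ≤ η ∧
    Real.exp (-((2 * √(-Real.log Δ)) ^ 2 / 2)) = Δ ^ 2 := by
  have t := tendsto_log_mul_rpow_nhdsGT_zero (r := 1 / 2) (by norm_num)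
  have t2 := ((t.pow 2).const_mul 16)
  have e := (tendsto_order.1 t2).2 η (by simpa using hη)
  have tl := Real.tendsto_log_nhdsGT_zero.eventually_le_atBot (-1)
  filter_upwards [e, tl, self_mem_nhdsWithin, Ioo_mem_nhdsGT hη] with Δ h1 h2 h0 h3
  have h0 : 0 < Δ := h0
  set L := Real.log Δ with hL
  have hsq : √(-L) ^ 2 = -L := Real.sq_sqrt (by linarith)
  have hs1 : 1 ≤ √(-L) := Real.one_le_sqrt.mpr (by linarith)
  have hM1 : 1 ≤ 2 * √(-L) := by linarith
  have h4 : Δ * (2 * √(-L)) ^ 4 < η := by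
    have : (L * Δ ^ (1 / 2 : ℝ)) ^ 2 = L ^ 2 * Δ := by
      rw [mul_pow, ← Real.rpow_natCast, ← Real.rpow_natCast, ← Real.rpow_mul h0.le]; norm_num
    rw [this] at h1
    calc Δ * (2 * √(-L)) ^ 4 = 16 * (Δ * (√(-L) ^ 2) ^ 2) := by ring
      _ = 16 * (L ^ 2 * Δ) := by rw [hsq]; ring
      _ < η := h1
  refine ⟨h0, h3.2, hM1, ?_, ?_, ?_⟩
  · refine le_trans ?_ h4.le
    gcongr Δ * ?_
    exact pow_le_pow_right₀ hM1 (by norm_num)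
  · refine le_trans ?_ h4.le
    gcongr Δ * ?_
    exact pow_le_pow_right₀ hM1 (by norm_num)
  · rw [mul_pow, hsq, ← Real.exp_log (by positivity : 0 < Δ ^ 2), Real.log_pow]
    congr 1; push_cast; ring

lemma core (β : ℝ) (hβ : β ∈ Set.Ioo (-1 : ℝ) 1) (ε : ℝ) (hε : 0 < ε) :
    ∃ y₀ : ℝ, 2 ≤ y₀ ∧ ∀ᶠ Δ in 𝓝[>] (0 : ℝ), ∀ y : ℝ, y₀ ≤ y →
      |hh Δ β y - (normalDensity y + (1 + β) * Δ * y ^ (Δ - 3))| ≤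
        ε * (normalDensity y + (1 + β) * Δ * y ^ (Δ - 3)) := by
  obtain ⟨K1, hK1, G1⟩ := gauss_part
  obtain ⟨K2, hK2, G2⟩ := far_part
  obtain ⟨y₀, hy₀, T⟩ := tail_asymp (ε / 3) (by linarith)
  refine ⟨y₀, hy₀, ?_⟩
  have hb1 : 0 < 1 + β := by linarith [hβ.1]
  have hβ' : |β| ≤ 1 := abs_le.mpr ⟨hβ.1.le, hβ.2.le⟩
  set η := min (1 / 8) (min (ε / K1) (ε / 3 * (1 + β) / (1728 * (K2 + 1)))) with hη
  have hη0 : 0 < η := by positivity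
  have hη1 : η ≤ 1 / 8 := min_le_left _ _
  have hη2 : η ≤ ε / K1 := (min_le_right _ _).trans (min_le_left _ _)
  have hη3 : η ≤ ε / 3 * (1 + β) / (1728 * (K2 + 1)) := (min_le_right _ _).trans (min_le_right _ _)
  filter_upwards [T, ev_MM η hη0] with Δ hT hM y hy
  obtain ⟨h0, hΔη, hM1, hM2, hM3, hMe⟩ := hM
  set M := 2 * √(-Real.log Δ) with hMdef
  have h1 : Δ ≤ 1 / 8 := by linarith
  have hM2' : Δ * M ^ 2 ≤ 1 / 4 := by linarith
  have hy2 : 2 ≤ y := hy₀.trans hy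
  have hy0 : 0 < y := by linarith
  set F := (1 + β) * Δ * y ^ (Δ - 3) with hF
  have hF0 : 0 < F := by positivity
  have hN0 : 0 ≤ normalDensity y := by rw [normalDensity]; positivity
  rcases le_or_gt (y / 2) M with hc | hc
  · have t := hT β y (y / 2) hβ' hy (by linarith) le_rfl
    have g := G1 Δ β M y h0 h1 hβ' hM1 hM2' hy2 hc
    have g' : K1 * (Δ * M ^ 3) * normalDensity y ≤ ε * normalDensity y := by
      gcongr
      have : Δ * M ^ 3 ≤ ε / K1 := hM3.trans hη2
      rw [le_div_iff₀ hK1] at this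
      linarith
    rw [hh_split (Y := y / 2) h0 h1 hβ' hM1 hM2' (by linarith) hc]
    set A := 1 / π * ∫ s in (0 : ℝ)..(y / 2), VV Δ β y s
    set B := 1 / π * (∫ v in Ioi (0 : ℝ), GG Δ β y ((v : ℂ) + ((-(y / 2) : ℝ) : ℂ) * Complex.I)).re
    rw [show B + A - (normalDensity y + F) = (B - normalDensity y) + (A - F) by ring]
    refine (abs_add_le _ _).trans ?_
    have : ε / 3 * F ≤ ε * F := by gcongr; linarith
    linarith
  · have t := hT β y M hβ' hy hM1 hc.le
    have g := G2 Δ β M y h0 h1 hβ' hM1 hM2'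
    have hsmall : (K2 + 1) * (Δ ^ 2 * Real.exp (-(1 / 4) * y)) ≤ ε / 3 * F := by
      have c := cube_exp hy0.le
      have c2 : y ^ 3 ≤ 1728 * Real.exp (1 / 4 * y) :=
        le_trans (pow_le_pow_left₀ hy0.le (by linarith) 3) c
      have c3 : Real.exp (-(1 / 4) * y) ≤ 1728 * y ^ (Δ - 3) := by
        have c4 : Real.exp (-(1 / 4) * y) ≤ 1728 * (y ^ 3)⁻¹ := by
          rw [show -(1 / 4) * y = -(1 / 4 * y) by ring, Real.exp_neg, ← div_eq_mul_inv,
            le_div_iff₀ (by positivity), inv_mul_eq_div, div_le_iff₀ (Real.exp_pos _)]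
          exact c2
        have c5 : (y ^ 3)⁻¹ ≤ y ^ (Δ - 3) := by
          have : (y ^ 3)⁻¹ = y ^ (-3 : ℝ) := by
            rw [Real.rpow_neg hy0.le]; norm_cast
          rw [this]
          exact Real.rpow_le_rpow_of_exponent_le (by linarith) (by linarith)
        linarith
      have c6 : Δ * (1728 * (K2 + 1)) ≤ ε / 3 * (1 + β) := by
        have := hΔη.le.trans hη3
        rwa [le_div_iff₀ (by positivity)] at this
      calc (K2 + 1) * (Δ ^ 2 * Real.exp (-(1 / 4) * y)) ≤ (K2 + 1) * (Δ ^ 2 * (1728 * y ^ (Δ - 3))) := by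
            gcongr
        _ = Δ * (1728 * (K2 + 1)) * (Δ * y ^ (Δ - 3)) := by ring
        _ ≤ ε / 3 * (1 + β) * (Δ * y ^ (Δ - 3)) := by gcongr
        _ = ε / 3 * F := by rw [hF]; ring
    set D := Δ ^ 2 * Real.exp (-(1 / 4) * y) with hD
    have hD0 : 0 ≤ D := by positivity
    have hB : K2 * Real.exp (M ^ 2 - M * y) ≤ K2 * D := by
      gcongr
      rw [hD, ← hMe, ← Real.exp_add, Real.exp_le_exp]
      nlinarith
    have hN : normalDensity y ≤ D := by
      have n1 : 1 / (2 * √π) ≤ 1 := by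
        rw [div_le_one (by positivity)]
        have : 1 ≤ √π := Real.one_le_sqrt.mpr (by linarith [Real.pi_gt_three])
        linarith
      rw [normalDensity]
      refine (mul_le_of_le_one_left (Real.exp_pos _).le n1).trans ?_
      rw [hD, ← hMe, ← Real.exp_add, Real.exp_le_exp]
      nlinarith
    rw [hh_split (Y := M) h0 h1 hβ' hM1 hM2' (by linarith) le_rfl]
    set A := 1 / π * ∫ s in (0 : ℝ)..M, VV Δ β y s
    set B := 1 / π * (∫ v in Ioi (0 : ℝ), GG Δ β y ((v : ℂ) + ((-M : ℝ) : ℂ) * Complex.I)).re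
    have hK2D : 0 ≤ K2 * D := by positivity
    have hεF : 0 < ε * F := by positivity
    have hεN : 0 ≤ ε * normalDensity y := by positivity
    rw [show B + A - (normalDensity y + F) = B + (-normalDensity y + (A - F)) by ring]
    refine (abs_add_le _ _).trans ?_
    have := abs_add_le (-normalDensity y) (A - F)
    rw [abs_neg, abs_of_nonneg hN0] at this
    linarith

/-! ### Back to the original parameterization -/

lemma tan_shift (Δ : ℝ) : Real.tan (π * (2 - Δ) / 2) = -Real.tan (π * Δ / 2) := by
  rw [show π * (2 - Δ) / 2 = π - π * Δ / 2 by ring, Real.tan_pi_sub]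

lemma zeta_eq (Δ β : ℝ) : zetaPar (2 - Δ) β = β * Real.tan (π * Δ / 2) := by
  rw [zetaPar, tan_shift]; ring

lemma zeta_abs {Δ β : ℝ} (h0 : 0 < Δ) (h1 : Δ ≤ 1 / 8) (hβ : |β| ≤ 1) :
    |zetaPar (2 - Δ) β| ≤ 1 := by
  obtain ⟨t0, t1⟩ := tan_bound h0 h1
  rw [zeta_eq, abs_mul, abs_of_nonneg t0]
  calc |β| * Real.tan (π * Δ / 2) ≤ 1 * 1 := by gcongr; linarith
    _ = 1 := by norm_num

lemma stable_eq (Δ β x : ℝ) :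
    stableDensity (2 - Δ) β x = hh Δ β (x - zetaPar (2 - Δ) β) := by
  rw [stableDensity, hh]
  congr 2
  refine setIntegral_congr_fun measurableSet_Ioi fun t ht => ?_
  have ht : 0 < t := ht
  have hp : ((t ^ (2 - Δ) : ℝ) : ℂ) * ((t ^ (1 - (2 - Δ)) : ℝ) : ℂ) = (t : ℂ) := by
    rw [← Complex.ofReal_mul, ← Real.rpow_add ht]
    norm_num
  simp only [GG]
  rw [← Complex.exp_add, ← Complex.exp_add, zeta_eq, tan_shift, cc,
    ← Complex.ofReal_cpow ht.le]
  generalize Real.tan (π * Δ / 2) = τ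
  generalize ((t ^ (2 - Δ) : ℝ) : ℂ) = w at hp ⊢
  generalize ((t ^ (1 - (2 - Δ)) : ℝ) : ℂ) = w' at hp ⊢
  congr 1
  push_cast
  linear_combination (Complex.I * β * τ) * hp

lemma hh_neg (Δ β y : ℝ) : hh Δ β (-y) = hh Δ (-β) y := by
  rw [hh, hh]
  congr 1
  have : ∫ v in Ioi (0 : ℝ), GG Δ β (-y) (v : ℂ) =
      ∫ v in Ioi (0 : ℝ), (starRingEnd ℂ) (GG Δ (-β) y (v : ℂ)) := by
    refine setIntegral_congr_fun measurableSet_Ioi fun t ht => ?_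
    have ht : 0 < t := ht
    simp only [GG, cc]
    rw [map_mul, ← Complex.exp_conj, ← Complex.exp_conj, ← Complex.ofReal_cpow ht.le]
    generalize t ^ (2 - Δ) = w
    generalize Real.tan (π * Δ / 2) = τ
    simp only [map_neg, map_mul, map_add, map_one, Complex.conj_I, Complex.conj_ofReal]
    push_cast
    congr 2 <;> ring
  rw [this, integral_conj, Complex.conj_re]

lemma normalDensity_pos (y : ℝ) : 0 < normalDensity y := by
  have := Real.pi_pos
  rw [normalDensity]; positivity

lemma normalDensity_abs (y : ℝ) : normalDensity |y| = normalDensity y := by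
  rw [normalDensity, normalDensity, sq_abs]

lemma sign_bounds {β : ℝ} (y : ℝ) (hβ : |β| ≤ 1) :
    1 - |β| ≤ 1 + β * Real.sign y ∧ 1 + β * Real.sign y ≤ 2 := by
  have h : |β * Real.sign y| ≤ |β| := by
    rw [abs_mul]
    apply mul_le_of_le_one_right (abs_nonneg _)
    rcases Real.sign_apply_eq y with h | h | h <;> rw [h] <;> simp
  have := abs_le.mp h
  constructor <;> linarith

lemma part_one (β : ℝ) (hβ : β ∈ Set.Ioo (-1 : ℝ) 1) (ε : ℝ) (hε : 0 < ε) :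
    ∃ x₀ : ℝ, 2 ≤ x₀ ∧ ∀ᶠ Δ in 𝓝[>] (0 : ℝ), ∀ x : ℝ, x₀ < |x| →
      |stableDensity (2 - Δ) β x / gApprox (2 - Δ) β x - 1| < ε := by
  obtain ⟨y₁, hy₁, C1⟩ := core β hβ (ε / 2) (by linarith)
  obtain ⟨y₂, hy₂, C2⟩ := core (-β) ⟨by linarith [hβ.2], by linarith [hβ.1]⟩ (ε / 2) (by linarith)
  have hβ' : |β| ≤ 1 := abs_le.mpr ⟨hβ.1.le, hβ.2.le⟩
  have hβ'' : |β| < 1 := abs_lt.mpr ⟨hβ.1, hβ.2⟩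
  refine ⟨max y₁ y₂ + 1, by linarith [le_max_left y₁ y₂], ?_⟩
  filter_upwards [C1, C2, Ioc_mem_nhdsGT (show (0 : ℝ) < 1 / 8 by norm_num)] with Δ c1 c2 hΔ x hx
  have hz := zeta_abs hΔ.1 hΔ.2 hβ'
  rw [stable_eq, gApprox, F1, F2, show 2 - (2 - Δ) = Δ by ring]
  set y := x - zetaPar (2 - Δ) β with hy
  have hyabs : max y₁ y₂ ≤ |y| := by
    have := abs_sub_abs_le_abs_sub x (zetaPar (2 - Δ) β)
    linarith
  have h1 := (le_max_left y₁ y₂).trans hyabs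
  have h2 := (le_max_right y₁ y₂).trans hyabs
  have hyp : 0 < |y| := by linarith
  have hg : 0 < normalDensity y + (1 + β * Real.sign y) * Δ * |y| ^ (Δ - 3) := by
    have := (sign_bounds y hβ').1
    have s0 : 0 < 1 + β * Real.sign y := by linarith
    have := normalDensity_pos y
    have := Real.rpow_pos_of_pos hyp (Δ - 3)
    have := hΔ.1
    positivity
  have key : |hh Δ β y - (normalDensity y + (1 + β * Real.sign y) * Δ * |y| ^ (Δ - 3))| ≤
      ε / 2 * (normalDensity y + (1 + β * Real.sign y) * Δ * |y| ^ (Δ - 3)) := by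
    rcases lt_or_gt_of_ne (abs_pos.mp hyp) with hneg | hpos
    · have := c2 |y| h2
      rw [normalDensity_abs, ← hh_neg, abs_of_neg hneg, neg_neg] at this
      rw [Real.sign_of_neg hneg, abs_of_neg hneg, mul_neg, mul_one]
      exact this
    · have := c1 |y| h1
      rw [abs_of_pos hpos] at this
      rw [Real.sign_of_pos hpos, abs_of_pos hpos, mul_one]
      exact this
  rw [div_sub_one hg.ne', abs_div, abs_of_pos hg, div_lt_iff₀ hg]
  refine key.trans_lt ?_
  gcongr
  linarith

lemma exp_log_rpow {Δ k : ℝ} (h0 : 0 < Δ) : Real.exp (k * Real.log (1 / Δ)) = Δ ^ (-k) := by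
  rw [Real.rpow_def_of_pos h0, one_div, Real.log_inv]; congr 1; ring

lemma part_two_a {Δ β y δ : ℝ} (h0 : 0 < Δ) (h1 : Δ ≤ 1 / 8) (hβ : |β| < 1) (hy : 1 ≤ |y|)
    (h : |y| ≤ (2 - δ) * √(Real.log (1 / Δ))) :
    |(normalDensity y + (1 + β * Real.sign y) * Δ * |y| ^ (Δ - 3)) / normalDensity y - 1| ≤
      4 * √π * Δ ^ (δ - δ ^ 2 / 4) := by
  have hN := normalDensity_pos y
  obtain ⟨s1, s2⟩ := sign_bounds y hβ.le
  have s0 : 0 < 1 + β * Real.sign y := by linarith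
  have hy0 : 0 < |y| := by linarith
  have hr : 0 < |y| ^ (Δ - 3) := Real.rpow_pos_of_pos hy0 _
  have hr1 : |y| ^ (Δ - 3) ≤ 1 := Real.rpow_le_one_of_one_le_of_nonpos hy (by linarith)
  have hlog : 0 ≤ Real.log (1 / Δ) :=
    Real.log_nonneg (by rw [le_div_iff₀ h0]; linarith)
  have hsq : y ^ 2 ≤ (2 - δ) ^ 2 * Real.log (1 / Δ) := by
    calc y ^ 2 = |y| ^ 2 := (sq_abs y).symm
      _ ≤ ((2 - δ) * √(Real.log (1 / Δ))) ^ 2 := by gcongr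
      _ = _ := by rw [mul_pow, Real.sq_sqrt hlog]
  rw [add_div, div_self hN.ne', add_sub_cancel_left, abs_of_pos (by positivity), normalDensity]
  have hpi := Real.pi_pos
  have e1 : (1 + β * Real.sign y) * Δ * |y| ^ (Δ - 3) / (1 / (2 * √π) * Real.exp (-(y ^ 2) / 4)) =
      (1 + β * Real.sign y) * Δ * |y| ^ (Δ - 3) * (2 * √π) * Real.exp (y ^ 2 / 4) := by
    rw [show -(y ^ 2) / 4 = -(y ^ 2 / 4) by ring, Real.exp_neg]
    field_simp
  rw [e1]
  have e2 : Real.exp (y ^ 2 / 4) ≤ Δ ^ (-((2 - δ) ^ 2 / 4)) := by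
    rw [← exp_log_rpow h0, Real.exp_le_exp]; linarith
  have e3 : Δ * Δ ^ (-((2 - δ) ^ 2 / 4)) = Δ ^ (δ - δ ^ 2 / 4) := by
    nth_rewrite 1 [← Real.rpow_one Δ]
    rw [← Real.rpow_add h0]; congr 1; ring
  calc _ ≤ 2 * Δ * 1 * (2 * √π) * Δ ^ (-((2 - δ) ^ 2 / 4)) := by gcongr
    _ = 4 * √π * (Δ * Δ ^ (-((2 - δ) ^ 2 / 4))) := by ring
    _ = _ := by rw [e3]

lemma part_two_b {Δ β y δ : ℝ} (h0 : 0 < Δ) (h1 : Δ ≤ 1 / 8) (hβ : |β| < 1) (hy : 1 ≤ |y|)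
    (hδ : 0 < δ) (h : (2 + δ) * √(Real.log (1 / Δ)) ≤ |y|) :
    |(normalDensity y + (1 + β * Real.sign y) * Δ * |y| ^ (Δ - 3)) /
      ((1 + β * Real.sign y) * Δ * |y| ^ (Δ - 3)) - 1| ≤
      32 / ((δ ^ 2 / (2 + δ) ^ 2) ^ 2 * (1 - |β|)) * Δ ^ δ := by
  have hN := normalDensity_pos y
  obtain ⟨s1, s2⟩ := sign_bounds y hβ.le
  have s0 : 0 < 1 + β * Real.sign y := by linarith
  have hy0 : 0 < |y| := by linarith
  have hr : 0 < |y| ^ (Δ - 3) := Real.rpow_pos_of_pos hy0 _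
  have hlog : 0 ≤ Real.log (1 / Δ) :=
    Real.log_nonneg (by rw [le_div_iff₀ h0]; linarith)
  have hsq : (2 + δ) ^ 2 * Real.log (1 / Δ) ≤ y ^ 2 := by
    calc (2 + δ) ^ 2 * Real.log (1 / Δ) = ((2 + δ) * √(Real.log (1 / Δ))) ^ 2 := by
          rw [mul_pow, Real.sq_sqrt hlog]
      _ ≤ |y| ^ 2 := by gcongr
      _ = y ^ 2 := sq_abs y
  set s := δ ^ 2 / (2 + δ) ^ 2 with hs
  have hs0 : 0 < s := by positivity
  have hs1 : 0 ≤ 1 - s := by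
    rw [hs, sub_nonneg, div_le_one (by positivity)]; nlinarith
  have hs2 : (1 - s) * (2 + δ) ^ 2 = 4 * (1 + δ) := by
    rw [hs]; field_simp; ring
  have hF : 0 < (1 + β * Real.sign y) * Δ * |y| ^ (Δ - 3) := by positivity
  have hb0 : 0 < 1 - |β| := by linarith
  rw [add_div, div_self hF.ne', add_sub_cancel_right, abs_of_pos (by positivity),
    div_le_iff₀ hF]
  have n1 : normalDensity y ≤ Real.exp (-(y ^ 2) / 4) := by
    rw [normalDensity]
    apply mul_le_of_le_one_left (Real.exp_pos _).le
    have hpi := Real.pi_pos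
    rw [div_le_one (by positivity)]
    have : 1 ≤ √π := Real.one_le_sqrt.mpr (by linarith [Real.pi_gt_three])
    linarith
  have n2 : Real.exp (-(y ^ 2) / 4) = Real.exp (-((1 - s) * y ^ 2 / 4)) * Real.exp (-(s * y ^ 2 / 4)) := by
    rw [← Real.exp_add]; congr 1; ring
  have n3 : Real.exp (-((1 - s) * y ^ 2 / 4)) ≤ Δ ^ (1 + δ) := by
    have := exp_log_rpow (k := -(1 + δ)) h0
    rw [neg_neg] at this
    rw [← this, Real.exp_le_exp]
    nlinarith [mul_le_mul_of_nonneg_left hsq hs1]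
  have n4 : Real.exp (-(s * y ^ 2 / 4)) ≤ 32 / s ^ 2 * |y| ^ (Δ - 3) := by
    have q := Real.quadratic_le_exp_of_nonneg (x := s * y ^ 2 / 4) (by positivity)
    have q2 : s ^ 2 * |y| ^ 3 / 32 ≤ Real.exp (s * y ^ 2 / 4) := by
      have q3 : |y| ^ 3 ≤ |y| ^ 4 := pow_le_pow_right₀ hy (by norm_num)
      have q4 : |y| ^ 4 = y ^ 4 := by rw [show 4 = 2 * 2 by norm_num, pow_mul, pow_mul, sq_abs]
      have q5 : s ^ 2 * |y| ^ 3 ≤ s ^ 2 * y ^ 4 := by rw [← q4]; gcongr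
      have q6 : 0 ≤ s * y ^ 2 / 4 := by positivity
      have q7 : (s * y ^ 2 / 4) ^ 2 / 2 = s ^ 2 * y ^ 4 / 32 := by ring
      linarith
    have q8 : (|y| ^ 3)⁻¹ ≤ |y| ^ (Δ - 3) := by
      have : (|y| ^ 3)⁻¹ = |y| ^ (-3 : ℝ) := by
        rw [Real.rpow_neg hy0.le]; norm_cast
      rw [this]
      exact Real.rpow_le_rpow_of_exponent_le hy (by linarith)
    calc Real.exp (-(s * y ^ 2 / 4)) = (Real.exp (s * y ^ 2 / 4))⁻¹ := Real.exp_neg _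
      _ ≤ (s ^ 2 * |y| ^ 3 / 32)⁻¹ := by gcongr
      _ = 32 / s ^ 2 * (|y| ^ 3)⁻¹ := by field_simp
      _ ≤ _ := by gcongr
  have n5 : Δ ^ (1 + δ) = Δ * Δ ^ δ := by rw [Real.rpow_add h0, Real.rpow_one]
  calc normalDensity y ≤ Δ ^ (1 + δ) * (32 / s ^ 2 * |y| ^ (Δ - 3)) := by
        refine n1.trans ?_
        rw [n2]
        gcongr
    _ = 32 / (s ^ 2 * (1 - |β|)) * Δ ^ δ * ((1 - |β|) * Δ * |y| ^ (Δ - 3)) := by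
        rw [n5]; field_simp
    _ ≤ _ := by gcongr

lemma part_two (β : ℝ) (hβ : β ∈ Set.Ioo (-1 : ℝ) 1) (Δ₀ x₀ : ℝ) (hΔ₀ : Δ₀ ≤ 1 / 8)
    (hx₀ : 2 ≤ x₀) : ∀ δ : ℝ, 0 < δ → ∃ r : ℝ → ℝ, (∀ Δ : ℝ, 0 ≤ r Δ) ∧
        Filter.Tendsto (fun Δ : ℝ => r Δ / Δ ^ (δ / 2)) (nhdsWithin 0 (Set.Ioi 0)) (nhds 0) ∧
        ∀ Δ : ℝ, 0 < Δ → Δ < Δ₀ → ∀ x : ℝ, x₀ < |x| →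
          (|x - zetaPar (2 - Δ) β| ≤ (2 - δ) * Real.sqrt (Real.log (1 / Δ)) →
            |gApprox (2 - Δ) β x / F1 (2 - Δ) β x - 1| ≤ r Δ) ∧
          ((2 + δ) * Real.sqrt (Real.log (1 / Δ)) ≤ |x - zetaPar (2 - Δ) β| →
            |gApprox (2 - Δ) β x / F2 (2 - Δ) β x - 1| ≤ r Δ) := by
  intro δ hδ
  have hβ' : |β| < 1 := abs_lt.mpr ⟨hβ.1, hβ.2⟩
  have hb0 : 0 < 1 - |β| := by linarith
  obtain ⟨κ, hκ, hκ2⟩ : ∃ κ : ℝ, δ / 2 < κ ∧ (δ < 2 → κ = δ - δ ^ 2 / 4) := by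
    by_cases h : δ < 2
    · exact ⟨δ - δ ^ 2 / 4, by nlinarith, fun _ => rfl⟩
    · exact ⟨δ, by linarith, fun h' => absurd h' h⟩
  set K1 := 4 * √π
  set K2 := 32 / ((δ ^ 2 / (2 + δ) ^ 2) ^ 2 * (1 - |β|)) with hK2
  have hK1 : 0 ≤ K1 := by positivity
  have hK20 : 0 ≤ K2 := by positivity
  refine ⟨fun Δ => K1 * |Δ| ^ κ + K2 * |Δ| ^ δ, fun Δ => by positivity, ?_, ?_⟩
  · have l : ∀ p : ℝ, 0 < p → Tendsto (fun Δ : ℝ => Δ ^ p) (𝓝[>] 0) (𝓝 0) := by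
      intro p hp
      have := (Real.continuousAt_rpow_const 0 p (Or.inr hp.le)).tendsto
      rw [Real.zero_rpow hp.ne'] at this
      exact this.mono_left nhdsWithin_le_nhds
    have := ((l (κ - δ / 2) (by linarith)).const_mul K1).add ((l (δ - δ / 2) (by linarith)).const_mul K2)
    simp only [mul_zero, add_zero] at this
    refine this.congr' ?_
    filter_upwards [self_mem_nhdsWithin] with Δ hΔ
    have hΔ : 0 < Δ := hΔ
    rw [abs_of_pos hΔ, Real.rpow_sub hΔ, Real.rpow_sub hΔ]
    ring
  · intro Δ h0 h1 x hx
    have h1' : Δ ≤ 1 / 8 := by linarith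
    have hz := zeta_abs h0 h1' hβ'.le
    rw [gApprox, F1, F2, show 2 - (2 - Δ) = Δ by ring]
    set y := x - zetaPar (2 - Δ) β with hy
    have hyabs : 1 ≤ |y| := by
      have := abs_sub_abs_le_abs_sub x (zetaPar (2 - Δ) β)
      linarith
    simp only [abs_of_pos h0]
    constructor
    · intro h
      have hδ2 : δ < 2 := by
        by_contra hcon
        have : (2 - δ) * √(Real.log (1 / Δ)) ≤ 0 :=
          mul_nonpos_of_nonpos_of_nonneg (by linarith) (Real.sqrt_nonneg _)
        linarith
      have := part_two_a h0 h1' hβ' hyabs h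
      rw [← hκ2 hδ2] at this
      have : 0 ≤ K2 * Δ ^ δ := by positivity
      linarith
    · intro h
      have := part_two_b h0 h1' hβ' hyabs hδ h
      have : 0 ≤ K1 * Δ ^ κ := by positivity
      linarith


theorem density_ratio_approximation (β : ℝ) (hβ : β ∈ Set.Ioo (-1 : ℝ) 1)
    (ε : ℝ) (hε : 0 < ε) :
    ∃ Δ₀ > (0 : ℝ), ∃ x₀ > (0 : ℝ),
      (∀ Δ : ℝ, 0 < Δ → Δ < Δ₀ → ∀ x : ℝ, x₀ < |x| →
        |stableDensity (2 - Δ) β x / gApprox (2 - Δ) β x - 1| < ε) ∧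
      (∀ δ : ℝ, 0 < δ → ∃ r : ℝ → ℝ, (∀ Δ : ℝ, 0 ≤ r Δ) ∧
        Filter.Tendsto (fun Δ : ℝ => r Δ / Δ ^ (δ / 2)) (nhdsWithin 0 (Set.Ioi 0)) (nhds 0) ∧
        ∀ Δ : ℝ, 0 < Δ → Δ < Δ₀ → ∀ x : ℝ, x₀ < |x| →
          (|x - zetaPar (2 - Δ) β| ≤ (2 - δ) * Real.sqrt (Real.log (1 / Δ)) →
            |gApprox (2 - Δ) β x / F1 (2 - Δ) β x - 1| ≤ r Δ) ∧
          ((2 + δ) * Real.sqrt (Real.log (1 / Δ)) ≤ |x - zetaPar (2 - Δ) β| →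
            |gApprox (2 - Δ) β x / F2 (2 - Δ) β x - 1| ≤ r Δ)) := by
  obtain ⟨x₀, hx₀, H⟩ := part_one β hβ ε hε
  obtain ⟨u, hu, hsub⟩ := mem_nhdsGT_iff_exists_Ioo_subset.mp H
  have hu : 0 < u := hu
  refine ⟨min u (1/8), by positivity, x₀, by linarith, ?_, part_two β hβ _ _ (min_le_right _ _) hx₀⟩
  intro Δ h0 h1 x hx
  exact hsub ⟨h0, h1.trans_le (min_le_left _ _)⟩ x hx
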